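/- Let Γ be a finite simple graph, let G = G_Γ, and let P₁ = g₁G_{Λ₁}g₁⁻¹ and P₂ = g₂G_{Λ₂}g₂⁻¹ be two distinct maximal join parabolic subgroups of G, with centers Z₁ and Z₂ respectively, where Z_i = g_iG_{K_i}g_i⁻¹ with K_i the set of vertices of Λ_i adjacent in Λ_i to every other vertex of Λ_i. If every element of Z₁ commutes with every element of Z₂, then Z₁ ⊆ Z₂⊥ and Z₂ ⊆ Z₁⊥, where Z_i⊥ = g_iG_{K_i⊥}g_i⁻¹. -/

import Mathlib

open MeasureTheory
open scoped ENNReal Pointwise symmDiff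

namespace OEPaper

/- ## Right-angled Artin groups and graph combinatorics -/

/-- The commutation relations defining the right-angled Artin group of a graph. -/
def raagRels {V : Type} (Γ : SimpleGraph V) : Set (FreeGroup V) :=
  {r | ∃ u v : V, Γ.Adj u v ∧
    r = FreeGroup.of u * FreeGroup.of v * (FreeGroup.of u)⁻¹ * (FreeGroup.of v)⁻¹}

/-- The right-angled Artin group of a simple graph `Γ`. -/
abbrev RAAG {V : Type} (Γ : SimpleGraph V) : Type := PresentedGroup (raagRels Γ)

/-- The standard generator of `RAAG Γ` associated to a vertex. -/
def gen {V : Type} (Γ : SimpleGraph V) (v : V) : RAAG Γ := PresentedGroup.of v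

/-- The standard subgroup associated to (the full subgraph spanned by) a set of vertices. -/
def standardSub {V : Type} (Γ : SimpleGraph V) (S : Set V) : Subgroup (RAAG Γ) :=
  Subgroup.closure (gen Γ '' S)

/-- Conjugate of a subgroup. -/
def conjSub {G : Type} [Group G] (g : G) (P : Subgroup G) : Subgroup G :=
  Subgroup.map (MulAut.conj g).toMonoidHom P

/-- Parabolic subgroups: conjugates of standard subgroups. -/
def IsParabolic {V : Type} (Γ : SimpleGraph V) (P : Subgroup (RAAG Γ)) : Prop :=
  ∃ (g : RAAG Γ) (S : Set V), P = conjSub g (standardSub Γ S)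

/-- The "orthogonal" of a set of vertices: vertices outside `S` adjacent to every vertex of `S`. -/
def perp {V : Type} (Γ : SimpleGraph V) (S : Set V) : Set V :=
  {v : V | v ∉ S ∧ ∀ u ∈ S, Γ.Adj v u}

/-- `S` spans a join subgraph of `Γ`. -/
def IsJoin {V : Type} (Γ : SimpleGraph V) (S : Set V) : Prop :=
  ∃ S₁ S₂ : Set V, S₁.Nonempty ∧ S₂.Nonempty ∧ S₁ ∪ S₂ = S ∧ ∀ u ∈ S₁, ∀ v ∈ S₂, Γ.Adj u v

/-- `S` spans a maximal join subgraph of `Γ`. -/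
def IsMaxJoin {V : Type} (Γ : SimpleGraph V) (S : Set V) : Prop :=
  IsJoin Γ S ∧ ∀ T : Set V, IsJoin Γ T → S ⊆ T → S = T

/-- Join parabolic subgroups. -/
def IsJoinParabolic {V : Type} (Γ : SimpleGraph V) (P : Subgroup (RAAG Γ)) : Prop :=
  ∃ (g : RAAG Γ) (S : Set V), IsJoin Γ S ∧ P = conjSub g (standardSub Γ S)

/-- Maximal join parabolic subgroups. -/
def IsMaxJoinParabolic {V : Type} (Γ : SimpleGraph V) (P : Subgroup (RAAG Γ)) : Prop :=
  ∃ (g : RAAG Γ) (S : Set V), IsMaxJoin Γ S ∧ P = conjSub g (standardSub Γ S)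

/-- The center of a subgroup `P`, as a subset of the ambient group. -/
def subCenter {G : Type} [Group G] (P : Subgroup G) : Set G :=
  {x : G | x ∈ P ∧ ∀ y ∈ P, x * y = y * x}

/-- The commutation graph of a subset `S` of a group. -/
def chainCommGraph {G : Type} [Group G] (S : Set G) : SimpleGraph S :=
  SimpleGraph.fromRel fun a b => Commute (a : G) (b : G)

/-- A generating set is chain-commuting if its commutation graph is connected. -/
def IsChainCommuting {G : Type} [Group G] (S : Set G) : Prop :=
  (chainCommGraph S).Connected

/-- Amenability: existence of a finitely additive left-invariant probability
measure defined on all subsets. -/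
def IsAmenable (G : Type) [Group G] : Prop :=
  ∃ m : Set G → ℝ, m Set.univ = 1 ∧ (∀ A : Set G, 0 ≤ m A) ∧
    (∀ A B : Set G, Disjoint A B → m (A ∪ B) = m A + m B) ∧
    ∀ (g : G) (A : Set G), m ((g * ·) '' A) = m A

/-- ICC groups: every nontrivial element has an infinite conjugacy class. -/
def IsICC (G : Type) [Group G] : Prop :=
  ∀ g : G, g ≠ 1 → {h : G | ∃ c : G, c * g * c⁻¹ = h}.Infinite

/-- The root-conjugation property. -/
def RootConjugationProperty (H : Type) [Group H] : Prop :=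
  ∀ (h₁ h₂ : H) (k : ℕ), 0 < k → Commute h₁ (h₂ ^ k) → Commute h₁ h₂

/- ## Measured dynamics -/

/-- Measure-preserving action by measurable automorphisms. -/
def PmpAction (G : Type) [Group G] (X : Type) [MeasurableSpace X] [MulAction G X]
    (μ : Measure X) : Prop :=
  ∀ g : G, MeasurePreserving (fun x : X => g • x) μ μ

/-- Essentially free action. -/
def FreeAction (G : Type) [Group G] (X : Type) [MeasurableSpace X] [MulAction G X]
    (μ : Measure X) : Prop :=
  ∀ g : G, g ≠ 1 → μ {x : X | g • x = x} = 0

/-- Ergodic action of a group. -/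
def ErgodicAction (G : Type) [Group G] (X : Type) [MeasurableSpace X] [MulAction G X]
    (μ : Measure X) : Prop :=
  ∀ A : Set X, MeasurableSet A → (∀ g : G, (fun x : X => g • x) ⁻¹' A = A) →
    μ A = 0 ∨ μ A = 1

/-- Ergodicity of the action of a subgroup. -/
def ErgodicSubgroup (G : Type) [Group G] (A : Subgroup G) (X : Type) [MeasurableSpace X]
    [MulAction G X] (μ : Measure X) : Prop :=
  ∀ s : Set X, MeasurableSet s → (∀ a ∈ A, (fun x : X => a • x) ⁻¹' s = s) →
    μ s = 0 ∨ μ s = 1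

/-- Irreducible action of a right-angled Artin group: for some identification of the group
with a `RAAG Δ`, every standard generator acts ergodically. -/
def IrreducibleAction (G : Type) [Group G] (X : Type) [MeasurableSpace X] [MulAction G X]
    (μ : Measure X) : Prop :=
  ∃ (n : ℕ) (Δ : SimpleGraph (Fin n)) (e : RAAG Δ ≃* G),
    ∀ v : Fin n, Ergodic (fun x : X => e (gen Δ v) • x) μ

/-- A measure space isomorphism (mod null sets): a measurable measure-preserving map
admitting an a.e. two-sided measurable inverse. -/
def MeasIso {A : Type} {B : Type} [MeasurableSpace A] [MeasurableSpace B]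
    (μ : Measure A) (ν : Measure B) (F : A → B) : Prop :=
  Measurable F ∧ MeasurePreserving F μ ν ∧
    ∃ F' : B → A, Measurable F' ∧ (∀ᵐ a ∂μ, F' (F a) = a) ∧ ∀ᵐ b ∂ν, F (F' b) = b

/-- Conjugacy of two actions through a given group isomorphism. -/
def ConjugateVia (G : Type) [Group G] (X : Type) [MeasurableSpace X] [MulAction G X]
    (H : Type) [Group H] (Y : Type) [MeasurableSpace Y] [MulAction H Y]
    (μ : Measure X) (ν : Measure Y) (α : G ≃* H) : Prop :=
  ∃ F : X → Y, MeasIso μ ν F ∧ ∀ g : G, ∀ᵐ x ∂μ, F (g • x) = α g • F x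

/-- Conjugacy of two actions. -/
def ConjugateActions (G : Type) [Group G] (X : Type) [MeasurableSpace X] [MulAction G X]
    (H : Type) [Group H] (Y : Type) [MeasurableSpace Y] [MulAction H Y]
    (μ : Measure X) (ν : Measure Y) : Prop :=
  ∃ α : G ≃* H, ConjugateVia G X H Y μ ν α

/-- Orbit equivalence of two actions. -/
def OrbitEquivalent (G : Type) [Group G] (X : Type) [MeasurableSpace X] [MulAction G X]
    (H : Type) [Group H] (Y : Type) [MeasurableSpace Y] [MulAction H Y]
    (μ : Measure X) (ν : Measure Y) : Prop :=
  ∃ F : X → Y, MeasIso μ ν F ∧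
    ∀ᵐ x ∂μ, F '' MulAction.orbit G x = MulAction.orbit H (F x)

/-- Measurable cocycle for an action, with values in a (discrete) group `H`. -/
def IsCocycle (G : Type) [Group G] (X : Type) [MeasurableSpace X] [MulAction G X]
    (H : Type) [Group H] (μ : Measure X) (c : G → X → H) : Prop :=
  (∀ (g : G) (h : H), MeasurableSet {x : X | c g x = h}) ∧
    ∀ g g' : G, ∀ᵐ x ∂μ, c (g * g') x = c g (g' • x) * c g' x

/-- Cohomology of cocycles. -/
def Cohomologous (G : Type) [Group G] (X : Type) [MeasurableSpace X] [MulAction G X]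
    (H : Type) [Group H] (μ : Measure X) (c c' : G → X → H) : Prop :=
  ∃ φ : X → H, (∀ h : H, MeasurableSet {x : X | φ x = h}) ∧
    ∀ g : G, ∀ᵐ x ∂μ, c' g x = φ (g • x) * c g x * (φ x)⁻¹

/-- A stable orbit equivalence between two actions: a measure-scaling Borel isomorphism
between positive measure subsets, matching orbits. -/
structure StableOE (G : Type) [Group G] (X : Type) [MeasurableSpace X] [MulAction G X]
    (H : Type) [Group H] (Y : Type) [MeasurableSpace Y] [MulAction H Y]
    (μ : Measure X) (ν : Measure Y) where
  U : Set X
  V : Set Y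
  measU : MeasurableSet U
  measV : MeasurableSet V
  posU : 0 < μ U
  posV : 0 < ν V
  toFun : X → Y
  invFun : Y → X
  meas_toFun : Measurable toFun
  meas_invFun : Measurable invFun
  maps : Set.MapsTo toFun U V
  maps_inv : Set.MapsTo invFun V U
  left_inv : ∀ x ∈ U, invFun (toFun x) = x
  right_inv : ∀ y ∈ V, toFun (invFun y) = y
  pushforward : ∀ B : Set Y, B ⊆ V → MeasurableSet B →
    (μ U)⁻¹ * μ (U ∩ toFun ⁻¹' B) = (ν V)⁻¹ * ν B
  orbit_eq : ∀ᵐ x ∂μ, x ∈ U →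
    toFun '' (MulAction.orbit G x ∩ U) = MulAction.orbit H (toFun x) ∩ V

namespace StableOE

variable {G : Type} [Group G] {X : Type} [MeasurableSpace X] [MulAction G X]
  {H : Type} [Group H] {Y : Type} [MeasurableSpace Y] [MulAction H Y]
  {μ : Measure X} {ν : Measure Y}

/-- The compression constant of a stable orbit equivalence. -/
noncomputable def kappa (f : StableOE G X H Y μ ν) : ℝ≥0∞ := ν f.V / μ f.U

/-- `c` is an SOE cocycle associated to the stable orbit equivalence `f`. -/
def IsSOECocycle (f : StableOE G X H Y μ ν) (c : G → X → H) : Prop :=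
  IsCocycle G X H μ c ∧
    ∃ p : X → X, Measurable p ∧
      (∀ᵐ x ∂μ, p x ∈ f.U ∧ p x ∈ MulAction.orbit G x) ∧
      ∀ g : G, ∀ᵐ x ∂μ, f.toFun (p (g • x)) = c g x • f.toFun (p x)

end StableOE

/-- Mildly mixing action. -/
def MildlyMixing (H : Type) [Group H] (Y : Type) [MeasurableSpace Y] [MulAction H Y]
    (ν : Measure Y) : Prop :=
  ∀ A : Set Y, MeasurableSet A → ν A ≠ 0 → ν A ≠ ν Set.univ →
    ∀ u : ℕ → H, Function.Injective u →
      0 < Filter.atTop.liminf fun n => ν (((u n • ·) '' A) ∆ A)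

/- ## Virtual conjugacy -/

/-- `(Z, qact, ρ)` together with `π : X → Z` is a model for the quotient of the action
`G ↷ (X, μ)` by the normal subgroup `F`, with the induced `G ⧸ F`-action. -/
def IsQuotientModel {G : Type} [Group G] (F : Subgroup G) [F.Normal]
    {X : Type} [MeasurableSpace X] [MulAction G X] (μ : Measure X)
    {Z : Type} [MeasurableSpace Z] (qact : G ⧸ F →* Equiv.Perm Z) (ρ : Measure Z)
    (π : X → Z) : Prop :=
  Measurable π ∧ Measure.map π μ = ρ ∧
    (∀ (g : G) (x : X), π (g • x) = qact (QuotientGroup.mk g) (π x)) ∧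
    ∀ x y : X, π x = π y ↔ ∃ f ∈ F, f • x = y

/-- The action `act : Q →* Perm Z` on `(Z, ρ)` is (isomorphic to) the action induced from the
action `act' : K →* Perm X'` of the finite-index subgroup `K` on `(X', μ')`. -/
def InducedFrom {Q : Type} [Group Q] (K : Subgroup Q)
    {Z : Type} [MeasurableSpace Z] (act : Q →* Equiv.Perm Z) (ρ : Measure Z)
    {X' : Type} [MeasurableSpace X'] (act' : ↥K →* Equiv.Perm X') (μ' : Measure X') : Prop :=
  letI : MeasurableSpace (Q ⧸ K) := ⊤
  ∃ σ : Q ⧸ K → Q, (∀ k : Q ⧸ K, (QuotientGroup.mk (σ k) : Q ⧸ K) = k) ∧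
    ∃ Φ : X' × (Q ⧸ K) → Z,
      MeasIso (Measure.sum fun k : Q ⧸ K =>
        (K.index : ℝ≥0∞)⁻¹ • Measure.map (fun x' : X' => (x', k)) μ') ρ Φ ∧
      ∀ (g : Q) (k : Q ⧸ K) (h : ↥K), (h : Q) = (σ (g • k))⁻¹ * g * σ k →
        ∀ᵐ x' ∂μ', Φ (act' h x', g • k) = act g (Φ (x', k))

/-- Data witnessing that two probability measure-preserving actions are virtually
conjugate. -/
structure VirtualConjugacyData
    (G₁ : Type) [Group G₁] (X₁ : Type) [MeasurableSpace X₁] [MulAction G₁ X₁] (μ₁ : Measure X₁)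
    (G₂ : Type) [Group G₂] (X₂ : Type) [MeasurableSpace X₂] [MulAction G₂ X₂] (μ₂ : Measure X₂) :
    Type 1 where
  F₁ : Subgroup G₁
  F₂ : Subgroup G₂
  normal₁ : F₁.Normal
  normal₂ : F₂.Normal
  finite₁ : Finite F₁
  finite₂ : Finite F₂
  K₁ : Subgroup (G₁ ⧸ F₁)
  K₂ : Subgroup (G₂ ⧸ F₂)
  finiteIndex₁ : K₁.FiniteIndex
  finiteIndex₂ : K₂.FiniteIndex
  X'₁ : Type
  X'₂ : Type
  mX'₁ : MeasurableSpace X'₁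
  mX'₂ : MeasurableSpace X'₂
  μ'₁ : Measure X'₁
  μ'₂ : Measure X'₂
  prob₁ : IsProbabilityMeasure μ'₁
  prob₂ : IsProbabilityMeasure μ'₂
  act₁ : ↥K₁ →* Equiv.Perm X'₁
  act₂ : ↥K₂ →* Equiv.Perm X'₂
  pmp₁ : ∀ k : ↥K₁, MeasurePreserving (act₁ k) μ'₁ μ'₁
  pmp₂ : ∀ k : ↥K₂, MeasurePreserving (act₂ k) μ'₂ μ'₂
  θ : ↥K₁ ≃* ↥K₂
  conjF : X'₁ → X'₂
  conjF_iso : MeasIso μ'₁ μ'₂ conjF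
  conjF_equivariant : ∀ k : ↥K₁, ∀ᵐ x ∂μ'₁, conjF (act₁ k x) = act₂ (θ k) (conjF x)
  Z₁ : Type
  Z₂ : Type
  mZ₁ : MeasurableSpace Z₁
  mZ₂ : MeasurableSpace Z₂
  ρ₁ : Measure Z₁
  ρ₂ : Measure Z₂
  qact₁ : G₁ ⧸ F₁ →* Equiv.Perm Z₁
  qact₂ : G₂ ⧸ F₂ →* Equiv.Perm Z₂
  qpmp₁ : ∀ g, MeasurePreserving (qact₁ g) ρ₁ ρ₁
  qpmp₂ : ∀ g, MeasurePreserving (qact₂ g) ρ₂ ρ₂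
  π₁ : X₁ → Z₁
  π₂ : X₂ → Z₂
  quot₁ : IsQuotientModel F₁ μ₁ qact₁ ρ₁ π₁
  quot₂ : IsQuotientModel F₂ μ₂ qact₂ ρ₂ π₂
  ind₁ : InducedFrom K₁ qact₁ ρ₁ act₁ μ'₁
  ind₂ : InducedFrom K₂ qact₂ ρ₂ act₂ μ'₂

/- ## Bernoulli actions -/

/-- The Bernoulli shift action of `G` on `G → A`. -/
instance bernoulliAction (G A : Type) [Group G] : MulAction G (G → A) where
  smul g x := fun h => x (g⁻¹ * h)
  one_smul x := funext fun h => by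
    show x (1⁻¹ * h) = x h
    rw [inv_one, one_mul]
  mul_smul g g' x := funext fun h => by
    show x ((g * g')⁻¹ * h) = x (g'⁻¹ * (g⁻¹ * h))
    rw [mul_inv_rev, mul_assoc]

/-- `μ` is the product (Bernoulli) measure on `G → A` with base `μ₀`:
it gives the product value to every cylinder set. -/
def IsBernoulliMeasure (G : Type) [Group G] {A : Type} [MeasurableSpace A]
    (μ₀ : Measure A) (μ : Measure (G → A)) : Prop :=
  ∀ (s : Finset G) (B : G → Set A), (∀ g : G, MeasurableSet (B g)) →
    μ {x : G → A | ∀ g ∈ s, x g ∈ B g} = ∏ g ∈ s, μ₀ (B g)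


/-- `𝓕`-ergodicity: every subgroup in the collection `𝓕` acts ergodically. -/
def FErgodic (G : Type) [Group G] (𝓕 : Set (Subgroup G)) (X : Type) [MeasurableSpace X]
    [MulAction G X] (μ : Measure X) : Prop :=
  ∀ A ∈ 𝓕, ErgodicSubgroup G A X μ

/-- Strong cocycle-rigidity of the pair `(G, 𝓕)`. -/
def StronglyCocycleRigid (G : Type) [Group G] (𝓕 : Set (Subgroup G)) : Prop :=
  ∀ (X : Type) [MeasurableSpace X] [StandardBorelSpace X] (μ : Measure X)
    (Y : Type) [MeasurableSpace Y] [StandardBorelSpace Y] (ν : Measure Y)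
    [IsProbabilityMeasure μ] [IsProbabilityMeasure ν]
    [MulAction G X] [MulAction G Y],
    PmpAction G X μ → FreeAction G X μ → ErgodicAction G X μ → FErgodic G 𝓕 X μ →
    PmpAction G Y ν → FreeAction G Y ν → ErgodicAction G Y ν → FErgodic G 𝓕 Y ν →
    ∀ f : StableOE G X G Y μ ν, ∀ c : G → X → G, f.IsSOECocycle c →
      ∃ α : G ≃* G, Cohomologous G X G μ c fun g _ => α g



/- ## Centralizer of the stable letter of an HNN extension -/

theorem toSubgroup_self {H : Type*} [Group H] (L : Subgroup H) (u : ℤˣ) :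
    HNNExtension.toSubgroup L L u = L := by
  rcases Int.units_eq_one_or u with rfl | rfl <;> simp

open HNNExtension in
/-- An element of the HNN extension of `H` along the identity of `L` which commutes with the
stable letter lies in the subgroup generated by `L` and the stable letter. -/
theorem mem_of_commute_t {H : Type*} [Group H] (L : Subgroup H)
    (x : HNNExtension H L L (MulEquiv.refl L)) (hx : Commute x t) :
    x ∈ L.map of ⊔ Subgroup.zpowers t := by
  set C : Subgroup (HNNExtension H L L (MulEquiv.refl L)) :=
    L.map of ⊔ Subgroup.zpowers t with hC
  have hL : ∀ h ∈ L, (of h : HNNExtension H L L (MulEquiv.refl L)) ∈ C := fun h hh =>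
    le_sup_left (a := L.map of) (Subgroup.mem_map_of_mem _ hh)
  have ht : ∀ n : ℤ, (t : HNNExtension H L L (MulEquiv.refl L)) ^ n ∈ C := fun n =>
    le_sup_right (a := L.map of) (Subgroup.zpow_mem_zpowers _ n)
  have hLt : ∀ h ∈ L, Commute (of h : HNNExtension H L L (MulEquiv.refl L)) t := fun h hh =>
    (t_mul_of (φ := MulEquiv.refl L) ⟨h, hh⟩).symm
  have key : ∀ (n : ℕ) (w : NormalWord.ReducedWord H L L), w.toList.length = n →
      Commute (w.prod (MulEquiv.refl L)) t → w.prod (MulEquiv.refl L) ∈ C := by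
    intro n
    induction n with
    | zero =>
      rintro ⟨h, l, hl⟩ hn hw
      obtain rfl : l = [] := List.length_eq_zero_iff.1 hn
      let w₁ : NormalWord.ReducedWord H L L := ⟨h, [(1, 1)], List.isChain_singleton _⟩
      let w₂ : NormalWord.ReducedWord H L L := ⟨1, [(1, h)], List.isChain_singleton _⟩
      have hp : w₂.prod (MulEquiv.refl L) = w₁.prod (MulEquiv.refl L) := by
        simpa [w₁, w₂, NormalWord.ReducedWord.prod] using hw.eq.symm
      have := (ReducedWord.map_fst_eq_and_of_prod_eq _ hp).2 1 (by simp [w₂])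
      rw [toSubgroup_self] at this
      simpa [NormalWord.ReducedWord.prod] using hL h (by simpa [w₁, w₂] using this)
    | succ n ih =>
      rintro ⟨h, l, hl⟩ hn hw
      by_cases hh : h ∈ L
      · obtain ⟨⟨u, k⟩, l', rfl⟩ := List.exists_cons_of_length_eq_add_one hn
        let w' : NormalWord.ReducedWord H L L := ⟨k, l', (List.isChain_cons.1 hl).2⟩
        have hp : NormalWord.ReducedWord.prod (MulEquiv.refl L) ⟨h, (u, k) :: l', hl⟩ =
            of h * t ^ (u : ℤ) * w'.prod (MulEquiv.refl L) := by
          simp [w', NormalWord.ReducedWord.prod, mul_assoc]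
        have hc : Commute (of h * t ^ (u : ℤ)) (t : HNNExtension H L L (MulEquiv.refl L)) :=
          (hLt h hh).mul_left ((Commute.refl t).zpow_left _)
        rw [hp] at hw ⊢
        refine C.mul_mem (C.mul_mem (hL h hh) (ht _)) (ih w' (by simpa [w'] using hn) ?_)
        simpa only [inv_mul_cancel_left] using hc.inv_left.mul_left hw
      · obtain rfl | ⟨l', ⟨u, k⟩, rfl⟩ := List.eq_nil_or_concat' l
        · simp at hn
        by_cases hk : k ∈ L
        · let w' : NormalWord.ReducedWord H L L := ⟨h, l', hl.left_of_append⟩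
          have hp : NormalWord.ReducedWord.prod (MulEquiv.refl L) ⟨h, l' ++ [(u, k)], hl⟩ =
              w'.prod (MulEquiv.refl L) * (t ^ (u : ℤ) * of k) := by
            simp [w', NormalWord.ReducedWord.prod, mul_assoc]
          have hc : Commute (t ^ (u : ℤ) * of k) (t : HNNExtension H L L (MulEquiv.refl L)) :=
            ((Commute.refl t).zpow_left _).mul_left (hLt k hk)
          rw [hp] at hw ⊢
          refine C.mul_mem (ih w' (by simpa [w'] using hn) ?_) (C.mul_mem (ht _) (hL k hk))
          simpa only [mul_inv_cancel_right] using hw.mul_left hc.inv_left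
        · exfalso
          let w₁ : NormalWord.ReducedWord H L L := ⟨h, (l' ++ [(u, k)]) ++ [(1, 1)], by
            refine List.isChain_append.2 ⟨hl, List.isChain_singleton _, ?_⟩
            intro a ha b _ hab
            rw [toSubgroup_self] at hab
            obtain rfl : (u, k) = a := by simpa using ha
            exact absurd hab hk⟩
          let w₂ : NormalWord.ReducedWord H L L := ⟨1, (1, h) :: (l' ++ [(u, k)]), by
            refine List.isChain_cons.2 ⟨fun a _ hab => ?_, hl⟩
            rw [toSubgroup_self] at hab
            exact absurd hab hh⟩
          have hp : w₂.prod (MulEquiv.refl L) = w₁.prod (MulEquiv.refl L) := by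
            simpa [w₁, w₂, NormalWord.ReducedWord.prod, mul_assoc] using hw.eq.symm
          have := (ReducedWord.map_fst_eq_and_of_prod_eq _ hp).2 1 (by simp [w₂])
          rw [toSubgroup_self] at this
          exact hh (by simpa [w₁, w₂] using this)
  obtain ⟨d⟩ := NormalWord.TransversalPair.nonempty H L L
  have hprod := NormalWord.prod_smul (MulEquiv.refl L) x (NormalWord.empty (d := d))
  rw [NormalWord.prod_empty, mul_one] at hprod
  rw [← hprod] at hx ⊢
  exact key _ _ rfl hx

/- ## Right-angled Artin groups -/

section RAAG

variable {V : Type} {Γ : SimpleGraph V}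

theorem gen_commute {u v : V} (h : Γ.Adj u v) : Commute (gen Γ u) (gen Γ v) := by
  have : PresentedGroup.mk (raagRels Γ) (FreeGroup.of u * FreeGroup.of v *
      (FreeGroup.of u)⁻¹ * (FreeGroup.of v)⁻¹) = 1 :=
    (QuotientGroup.eq_one_iff _).2 (Subgroup.subset_normalClosure ⟨u, v, h, rfl⟩)
  simp only [map_mul, map_inv] at this
  have h2 : gen Γ u * gen Γ v * (gen Γ u)⁻¹ * (gen Γ v)⁻¹ = 1 := this
  rw [mul_inv_eq_one, mul_inv_eq_iff_eq_mul] at h2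
  exact h2

theorem gen_mem {S : Set V} {v : V} (hv : v ∈ S) : gen Γ v ∈ standardSub Γ S :=
  Subgroup.subset_closure ⟨v, hv, rfl⟩

theorem standardSub_le {S : Set V} {P : Subgroup (RAAG Γ)} :
    standardSub Γ S ≤ P ↔ ∀ v ∈ S, gen Γ v ∈ P := by
  simp [standardSub, Subgroup.closure_le, Set.subset_def]

theorem standardSub_univ : standardSub Γ Set.univ = ⊤ := by
  rw [standardSub, Set.image_univ]
  exact PresentedGroup.closure_range_of _

/-- The homomorphism out of a right-angled Artin group given by images of the generators. -/
def raagLift {G : Type*} [Group G] (f : V → G) (hf : ∀ u v, Γ.Adj u v → Commute (f u) (f v)) :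
    RAAG Γ →* G :=
  PresentedGroup.toGroup (f := f) (by
    rintro _ ⟨u, v, h, rfl⟩
    simp [(hf u v h).eq])

@[simp]
theorem raagLift_gen {G : Type*} [Group G] (f : V → G)
    (hf : ∀ u v, Γ.Adj u v → Commute (f u) (f v)) (v : V) :
    raagLift f hf (gen Γ v) = f v :=
  PresentedGroup.toGroup.of _

theorem gen_ne_one (v : V) : gen Γ v ≠ 1 := by
  intro h
  let f : RAAG Γ →* Multiplicative ℤ :=
    raagLift (fun _ => Multiplicative.ofAdd 1) fun _ _ _ => Commute.all _ _
  have hf : f (gen Γ v) = Multiplicative.ofAdd 1 := raagLift_gen _ _ _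
  rw [h, map_one] at hf
  exact absurd hf (by decide)

open Classical in
/-- The retraction of a right-angled Artin group onto a standard subgroup. -/
noncomputable def retract (Γ : SimpleGraph V) (S : Set V) : RAAG Γ →* RAAG Γ :=
  raagLift (fun v => if v ∈ S then gen Γ v else 1) (by
    intro u v h
    split_ifs
    exacts [gen_commute h, Commute.one_right _, Commute.one_left _, Commute.one_left _])

theorem retract_gen_of_notMem {S : Set V} {v : V} (hv : v ∉ S) :
    retract Γ S (gen Γ v) = 1 := by
  simp [retract, hv]

theorem retract_gen_of_mem {S : Set V} {v : V} (hv : v ∈ S) :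
    retract Γ S (gen Γ v) = gen Γ v := by
  simp [retract, hv]

theorem retract_eq_self {S : Set V} {x : RAAG Γ} (hx : x ∈ standardSub Γ S) :
    retract Γ S x = x := by
  have : standardSub Γ S ≤ (retract Γ S).eqLocus (MonoidHom.id _) :=
    standardSub_le.2 fun v hv => retract_gen_of_mem hv
  exact this hx

theorem retract_mem (S : Set V) (x : RAAG Γ) : retract Γ S x ∈ standardSub Γ S := by
  have : standardSub Γ Set.univ ≤ (standardSub Γ S).comap (retract Γ S) := by
    refine standardSub_le.2 fun v _ => ?_
    by_cases hv : v ∈ S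
    · simpa [retract_gen_of_mem hv] using gen_mem hv
    · simp [retract_gen_of_notMem hv, one_mem]
  exact this (standardSub_univ ▸ Subgroup.mem_top x)

/-- The centralizer of a generator is the standard subgroup of its star. -/
theorem mem_star_of_commute {v : V} {x : RAAG Γ} (hx : Commute x (gen Γ v)) :
    x ∈ standardSub Γ (insert v (Γ.neighborSet v)) := by
  classical
  let H := standardSub Γ {v}ᶜ
  let L : Subgroup H := (standardSub Γ (Γ.neighborSet v)).subgroupOf H
  let E := HNNExtension H L L (MulEquiv.refl L)
  have hgen : ∀ u, u ≠ v → gen Γ u ∈ H := fun u hu => gen_mem hu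
  let f : V → E := fun u =>
    if hu : u = v then HNNExtension.t else HNNExtension.of ⟨gen Γ u, hgen u hu⟩
  have hft : ∀ u, Γ.Adj v u → Commute (HNNExtension.t : E) (f u) := by
    intro u hu
    have hne : u ≠ v := hu.ne'
    have hm : (⟨gen Γ u, hgen u hne⟩ : H) ∈ L := Subgroup.mem_subgroupOf.2 (gen_mem hu)
    simp only [f, dif_neg hne]
    exact HNNExtension.t_mul_of (φ := MulEquiv.refl L) ⟨_, hm⟩
  have hfv : f v = HNNExtension.t := dif_pos rfl
  let φ : RAAG Γ →* E := raagLift f (by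
    intro a b hab
    by_cases ha : a = v
    · subst ha
      rw [hfv]
      exact hft b hab
    by_cases hb : b = v
    · subst hb
      rw [hfv]
      exact (hft a hab.symm).symm
    simp only [f, dif_neg ha, dif_neg hb]
    exact Commute.map (f := HNNExtension.of) (x := (⟨gen Γ a, hgen a ha⟩ : H))
      (y := ⟨gen Γ b, hgen b hb⟩) (Subtype.ext (gen_commute hab).eq))
  have hLcomm : standardSub Γ (Γ.neighborSet v) ≤ Subgroup.centralizer {gen Γ v} :=
    standardSub_le.2 fun u hu => Subgroup.mem_centralizer_singleton_iff.2 (gen_commute hu).eq.symm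
  let ψ : E →* RAAG Γ := HNNExtension.lift H.subtype (gen Γ v) fun a =>
    (Subgroup.mem_centralizer_singleton_iff.1 (hLcomm (Subgroup.mem_subgroupOf.1 a.2))).symm
  have hψφ : ψ.comp φ = MonoidHom.id _ := by
    refine PresentedGroup.ext fun u => ?_
    change ψ (φ (gen Γ u)) = gen Γ u
    simp only [φ, raagLift_gen]
    by_cases hu : u = v
    · subst hu
      rw [hfv]
      exact HNNExtension.lift_t _ _ _
    · simp only [f, dif_neg hu]
      exact HNNExtension.lift_of _ _ _ _
  have hφv : φ (gen Γ v) = HNNExtension.t := by rw [← hfv]; exact raagLift_gen _ _ _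
  have hmem := mem_of_commute_t L (φ x) (hφv ▸ hx.map φ)
  have hle : L.map HNNExtension.of ⊔ Subgroup.zpowers HNNExtension.t ≤
      (standardSub Γ (insert v (Γ.neighborSet v))).comap ψ := by
    refine sup_le ?_ ?_
    · rintro _ ⟨h, hh, rfl⟩
      have h1 : ψ (HNNExtension.of h) = h := HNNExtension.lift_of _ _ _ _
      rw [Subgroup.mem_comap, h1]
      exact Subgroup.closure_mono (Set.image_mono (Set.subset_insert _ _))
        (Subgroup.mem_subgroupOf.1 hh)
    · have h1 : ψ HNNExtension.t = gen Γ v := HNNExtension.lift_t _ _ _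
      rw [Subgroup.zpowers_le, Subgroup.mem_comap, h1]
      exact gen_mem (Set.mem_insert _ _)
  have hx' : ψ (φ x) = x := DFunLike.congr_fun hψφ x
  exact hx' ▸ hle hmem

theorem IsMaxJoin.eq_star {S : Set V} (hS : IsMaxJoin Γ S) {v : V} (hv : v ∈ S)
    (hadj : ∀ u ∈ S, u ≠ v → Γ.Adj v u) : S = insert v (Γ.neighborSet v) := by
  refine hS.2 _ ⟨{v}, Γ.neighborSet v, Set.singleton_nonempty v, ?_, Set.insert_eq _ _ |>.symm,
    ?_⟩ fun u hu => or_iff_not_imp_left.2 (hadj u hu)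
  · obtain ⟨A, B, ⟨a, ha⟩, ⟨b, hb⟩, rfl, hAB⟩ := hS.1
    by_cases hav : a = v
    · exact ⟨b, hav ▸ hAB a ha b hb⟩
    · exact ⟨a, hadj a (Or.inl ha) hav⟩
  · rintro _ rfl u hu
    exact hu

theorem mem_conjSub_iff {G : Type} [Group G] {g x : G} {P : Subgroup G} :
    x ∈ conjSub g P ↔ g⁻¹ * x * g ∈ P := by
  constructor
  · rintro ⟨y, hy, rfl⟩
    simpa [mul_assoc] using hy
  · intro h
    exact ⟨_, h, by simp [mul_assoc]⟩

theorem conj_mem_conjSub {G : Type} [Group G] {g x : G} {P : Subgroup G} (hx : x ∈ P) :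
    g * x * g⁻¹ ∈ conjSub g P :=
  ⟨x, hx, rfl⟩

theorem conjSub_eq_of_mem {G : Type} [Group G] {g₁ g₂ : G} {P : Subgroup G}
    (h : g₁⁻¹ * g₂ ∈ P) : conjSub g₁ P = conjSub g₂ P := by
  ext x
  rw [mem_conjSub_iff, mem_conjSub_iff]
  have : g₂⁻¹ * x * g₂ = (g₁⁻¹ * g₂)⁻¹ * (g₁⁻¹ * x * g₁) * (g₁⁻¹ * g₂) := by group
  rw [this, P.mul_mem_cancel_right h, P.mul_mem_cancel_left (P.inv_mem h)]

/-- One half of the mutual orthogonality of commuting centers. -/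
theorem center_le_perp (g₁ g₂ : RAAG Γ) (S₁ S₂ : Set V)
    (h₁ : IsMaxJoin Γ S₁) (h₂ : IsMaxJoin Γ S₂)
    (hne : conjSub g₁ (standardSub Γ S₁) ≠ conjSub g₂ (standardSub Γ S₂))
    (K₁ K₂ : Set V)
    (hK₁ : K₁ = {v : V | v ∈ S₁ ∧ ∀ u ∈ S₁, u ≠ v → Γ.Adj v u})
    (hK₂ : K₂ = {v : V | v ∈ S₂ ∧ ∀ u ∈ S₂, u ≠ v → Γ.Adj v u})
    (hcomm : ∀ x ∈ conjSub g₁ (standardSub Γ K₁), ∀ y ∈ conjSub g₂ (standardSub Γ K₂),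
      x * y = y * x) :
    conjSub g₂ (standardSub Γ K₂) ≤ conjSub g₁ (standardSub Γ (perp Γ K₁)) := by
  obtain rfl | ⟨v, hv⟩ := K₁.eq_empty_or_nonempty
  · have : perp Γ ∅ = Set.univ := by simp [perp]
    intro x _
    rw [this, standardSub_univ, mem_conjSub_iff]
    exact Subgroup.mem_top _
  have hadj₁ : ∀ k ∈ K₁, ∀ u ∈ S₁, u ≠ k → Γ.Adj k u := fun k hk => by
    rw [hK₁] at hk; exact hk.2
  have hsub₁ : K₁ ⊆ S₁ := fun k hk => by rw [hK₁] at hk; exact hk.1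
  have hstar₁ : ∀ k ∈ K₁, S₁ = insert k (Γ.neighborSet k) := fun k hk =>
    h₁.eq_star (hsub₁ hk) (hadj₁ k hk)
  have hperp : S₁ \ K₁ ⊆ perp Γ K₁ := fun u hu =>
    ⟨hu.2, fun k hk => (hadj₁ k hk u hu.1 fun h => hu.2 (h ▸ hk)).symm⟩
  have hnorm : standardSub Γ S₁ ≤
      Subgroup.normalizer (standardSub Γ (perp Γ K₁) : Set (RAAG Γ)) := by
    refine standardSub_le.2 fun u hu => ?_
    by_cases huK : u ∈ K₁
    · have hle : standardSub Γ (perp Γ K₁) ≤ Subgroup.centralizer {gen Γ u} :=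
        standardSub_le.2 fun a ha =>
          Subgroup.mem_centralizer_singleton_iff.2 (gen_commute (ha.2 u huK)).eq
      exact Subgroup.centralizer_le_normalizer _ <| Subgroup.mem_centralizer_iff.2 fun a ha =>
        Subgroup.mem_centralizer_singleton_iff.1 (hle ha)
    · exact Subgroup.le_normalizer (gen_mem (hperp ⟨hu, huK⟩))
  suffices standardSub Γ K₂ ≤
      (conjSub g₁ (standardSub Γ (perp Γ K₁))).comap (MulAut.conj g₂).toMonoidHom from
    Subgroup.map_le_iff_le_comap.2 this
  refine standardSub_le.2 fun w hw => ?_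
  set g := g₁⁻¹ * g₂ with hg
  have hconj : g₁⁻¹ * (g₂ * gen Γ w * g₂⁻¹) * g₁ = g * gen Γ w * g⁻¹ := by
    rw [hg]; group
  suffices g * gen Γ w * g⁻¹ ∈ standardSub Γ (perp Γ K₁) by
    rw [Subgroup.mem_comap, mem_conjSub_iff]
    exact hconj ▸ this
  have hmem : g * gen Γ w * g⁻¹ ∈ standardSub Γ S₁ := by
    rw [hstar₁ v hv]
    apply mem_star_of_commute
    have := hcomm _ (conj_mem_conjSub (gen_mem hv)) _ (conj_mem_conjSub (gen_mem hw))
    have h3 := congrArg (fun z => g₁⁻¹ * z * g₁) this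
    refine Commute.symm (?_ : _ * _ = _ * _)
    rw [← hconj]
    simpa [mul_assoc] using h3
  have hr := retract_eq_self hmem
  simp only [map_mul, map_inv] at hr
  have hwS : w ∈ S₁ := by
    by_contra hwS
    rw [retract_gen_of_notMem hwS] at hr
    have : gen Γ w = 1 := by simpa using hr.symm
    exact gen_ne_one w this
  rw [retract_gen_of_mem hwS] at hr
  have hrm := retract_mem S₁ g
  by_cases hwK : w ∈ K₁
  · exfalso
    have hle : standardSub Γ S₁ ≤ Subgroup.centralizer {gen Γ w} := by
      refine standardSub_le.2 fun a ha => Subgroup.mem_centralizer_singleton_iff.2 ?_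
      obtain rfl | haw := eq_or_ne a w
      · rfl
      · exact (gen_commute (hadj₁ w hwK a ha haw)).eq.symm
    rw [Subgroup.mem_centralizer_singleton_iff.1 (hle hrm), mul_inv_cancel_right] at hr
    have hgw : Commute g (gen Γ w) := (mul_inv_eq_iff_eq_mul.1 hr.symm)
    have hgS := mem_star_of_commute hgw
    rw [← hstar₁ w hwK] at hgS
    rw [hK₂] at hw
    rw [h₂.eq_star hw.1 hw.2, ← hstar₁ w hwK] at hne
    exact hne (conjSub_eq_of_mem hgS)
  · rw [← hr]
    exact (Subgroup.mem_normalizer_iff.1 (hnorm hrm) _).1 (gen_mem (hperp ⟨hwS, hwK⟩))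

end RAAG

/-- If the centers of two distinct maximal join parabolic subgroups commute,
then each center is contained in the orthogonal of the other. -/
theorem stmt13
    {V : Type} [Fintype V] (Γ : SimpleGraph V)
    (g₁ g₂ : RAAG Γ) (S₁ S₂ : Set V)
    (h₁ : IsMaxJoin Γ S₁) (h₂ : IsMaxJoin Γ S₂)
    (hne : conjSub g₁ (standardSub Γ S₁) ≠ conjSub g₂ (standardSub Γ S₂))
    (K₁ K₂ : Set V)
    (hK₁ : K₁ = {v : V | v ∈ S₁ ∧ ∀ u ∈ S₁, u ≠ v → Γ.Adj v u})
    (hK₂ : K₂ = {v : V | v ∈ S₂ ∧ ∀ u ∈ S₂, u ≠ v → Γ.Adj v u})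
    (hcomm : ∀ x ∈ conjSub g₁ (standardSub Γ K₁), ∀ y ∈ conjSub g₂ (standardSub Γ K₂),
      x * y = y * x) :
    conjSub g₁ (standardSub Γ K₁) ≤ conjSub g₂ (standardSub Γ (perp Γ K₂)) ∧
    conjSub g₂ (standardSub Γ K₂) ≤ conjSub g₁ (standardSub Γ (perp Γ K₁)) := by
  exact ⟨center_le_perp g₂ g₁ S₂ S₁ h₂ h₁ hne.symm K₂ K₁ hK₂ hK₁
      fun x hx y hy => (hcomm y hy x hx).symm,
    center_le_perp g₁ g₂ S₁ S₂ h₁ h₂ hne K₁ K₂ hK₁ hK₂ hcomm⟩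

end OEPaper
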